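/- Let 1 < α < 2 and define σ_n = 2^{α−1} · Γ(1−α)/(Γ(1−α/2))² · ( Γ(1+α/2)/Γ(2−α/2) − Γ(n+α/2)/Γ(1+n−α/2) ) for integers n ≥ 2. Then the sequence (σ_n)_{n≥2} is strictly increasing and bounded below by a positive constant, and there exist constants c > 0 and C > 0 such that c·n^{α−1} ≤ σ_n ≤ C·n^{α−1} for every n ≥ 2. -/

import Mathlib

open Real

/-- Wendel's upper bound for a ratio of Gamma values. -/
theorem Gamma_add_le_Gamma_mul_rpow {x p : ℝ} (hx : 0 < x) (hp0 : 0 < p) (hp1 : p < 1) :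
    Gamma (x + p) ≤ Gamma x * x ^ p := by
  have h := Gamma_mul_add_mul_le_rpow_Gamma_mul_rpow_Gamma hx (by linarith : 0 < x + 1)
    (sub_pos.2 hp1) hp0 (by ring)
  have hG := Gamma_pos_of_pos hx
  rw [show (1 - p) * x + p * (x + 1) = x + p by ring, Gamma_add_one hx.ne',
    mul_rpow hx.le hG.le, mul_left_comm, ← rpow_add hG, sub_add_cancel, rpow_one] at h
  linarith

/-- Wendel's lower bound for a ratio of Gamma values. -/
theorem mul_rpow_mul_Gamma_le {x p : ℝ} (hx : 0 < x) (hp0 : 0 < p) (hp1 : p < 1) :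
    x * (x + p) ^ p * Gamma x ≤ (x + p) * Gamma (x + p) := by
  have hy : 0 < x + p := by linarith
  have h := Gamma_add_le_Gamma_mul_rpow hy (sub_pos.2 hp1) (by linarith)
  rw [show x + p + (1 - p) = x + 1 by ring, Gamma_add_one hx.ne'] at h
  calc x * (x + p) ^ p * Gamma x = (x * Gamma x) * (x + p) ^ p := by ring
    _ ≤ (Gamma (x + p) * (x + p) ^ (1 - p)) * (x + p) ^ p := by gcongr
    _ = (x + p) * Gamma (x + p) := by
      rw [mul_assoc, ← rpow_add hy, sub_add_cancel, rpow_one, mul_comm]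

/-- The ratio `Γ(x + a) / Γ(1 + x - a)` increases under unit shifts when `1 / 2 < a < 1`. -/
theorem Gamma_ratio_lt_Gamma_ratio_add_one {x a : ℝ} (hx : 0 < x) (ha0 : 1 / 2 < a)
    (ha1 : a < 1) :
    Gamma (x + a) / Gamma (1 + x - a) < Gamma (x + 1 + a) / Gamma (1 + (x + 1) - a) := by
  have h1 : 0 < x + a := by linarith
  have h2 : 0 < 1 + x - a := by linarith
  have hG1 := Gamma_pos_of_pos h1
  have hG2 := Gamma_pos_of_pos h2
  rw [show x + 1 + a = (x + a) + 1 by ring, show 1 + (x + 1) - a = (1 + x - a) + 1 by ring,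
    Gamma_add_one h1.ne', Gamma_add_one h2.ne', div_lt_div_iff₀ hG2 (by positivity)]
  have := mul_pos hG1 hG2
  nlinarith

theorem Gamma_ratio_le {n a : ℝ} (hn : 1 ≤ n) (ha0 : 1 / 2 < a) (ha1 : a < 1) :
    Gamma (n + a) / Gamma (1 + n - a) ≤ 2 ^ (2 * a - 1) * n ^ (2 * a - 1) := by
  have h2 : 0 < 1 + n - a := by linarith
  have h := Gamma_add_le_Gamma_mul_rpow (p := 2 * a - 1) h2 (by linarith) (by linarith)
  rw [show 1 + n - a + (2 * a - 1) = n + a by ring] at h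
  rw [div_le_iff₀ (Gamma_pos_of_pos h2), ← mul_rpow (by norm_num) (by linarith), mul_comm]
  have hG := Gamma_pos_of_pos h2
  refine h.trans ?_
  gcongr
  · linarith
  · linarith

theorem le_Gamma_ratio {n a : ℝ} (hn : 1 ≤ n) (ha0 : 1 / 2 < a) (ha1 : a < 1) :
    n ^ (2 * a - 1) / 2 ≤ Gamma (n + a) / Gamma (1 + n - a) := by
  have h2 : 0 < 1 + n - a := by linarith
  have hna : 0 < n + a := by linarith
  have h := mul_rpow_mul_Gamma_le (p := 2 * a - 1) h2 (by linarith) (by linarith)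
  rw [show 1 + n - a + (2 * a - 1) = n + a by ring] at h
  have hG := Gamma_pos_of_pos h2
  rw [le_div_iff₀ hG]
  have hpow : n ^ (2 * a - 1) ≤ (n + a) ^ (2 * a - 1) := by
    gcongr <;> linarith
  have hx : (n + a) / 2 ≤ 1 + n - a := by linarith
  refine le_of_mul_le_mul_left ?_ hna
  calc (n + a) * (n ^ (2 * a - 1) / 2 * Gamma (1 + n - a))
      = (n + a) / 2 * n ^ (2 * a - 1) * Gamma (1 + n - a) := by ring
    _ ≤ (1 + n - a) * (n + a) ^ (2 * a - 1) * Gamma (1 + n - a) := by gcongr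
    _ ≤ _ := h

theorem Gamma_neg_of_neg_one_lt {x : ℝ} (hx : -1 < x) (hx0 : x < 0) : Gamma x < 0 := by
  have h := Gamma_pos_of_pos (by linarith : 0 < x + 1)
  rw [Gamma_add_one hx0.ne] at h
  exact neg_of_mul_pos_right h hx0.le

/-- Properties of the eigenvalue sequence `σ_n` for `1 < α < 2` (Proposition 3.4 /
Lemma A.1): `(σ_n)_{n≥2}` is strictly increasing, bounded below by a positive
constant, and `σ_n ≍ n^{α−1}`. -/
theorem sigma_properties_gSQG
    (α : ℝ) (hα1 : 1 < α) (hα2 : α < 2) (σ : ℕ → ℝ)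
    (hσ : ∀ n : ℕ, σ n =
        2 ^ (α - 1) * (Gamma (1 - α) / (Gamma (1 - α / 2)) ^ 2) *
          (Gamma (1 + α / 2) / Gamma (2 - α / 2) - Gamma (n + α / 2) / Gamma (1 + n - α / 2))) :
    (∀ n : ℕ, 2 ≤ n → σ n < σ (n + 1)) ∧
    (∃ m > (0 : ℝ), ∀ n : ℕ, 2 ≤ n → m ≤ σ n) ∧
    (∃ c > (0 : ℝ), ∃ C > (0 : ℝ), ∀ n : ℕ, 2 ≤ n →
      c * (n : ℝ) ^ (α - 1) ≤ σ n ∧ σ n ≤ C * (n : ℝ) ^ (α - 1)) := by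
  have ha0 : 1 / 2 < α / 2 := by linarith
  have ha1 : α / 2 < 1 := by linarith
  set R : ℕ → ℝ := fun n => Gamma (n + α / 2) / Gamma (1 + n - α / 2) with hR
  have hR1 : Gamma (1 + α / 2) / Gamma (2 - α / 2) = R 1 := by
    simp only [hR, Nat.cast_one]
    norm_num
  obtain ⟨K, hK, hσK⟩ : ∃ K > 0, ∀ n, σ n = K * (R n - R 1) := by
    refine ⟨2 ^ (α - 1) * (-Gamma (1 - α) / Gamma (1 - α / 2) ^ 2), ?_, fun n => ?_⟩
    · have h1 : 0 < -Gamma (1 - α) :=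
        neg_pos.2 (Gamma_neg_of_neg_one_lt (by linarith) (by linarith))
      have h2 : 0 < Gamma (1 - α / 2) := Gamma_pos_of_pos (by linarith)
      positivity
    · rw [hσ n, hR1]
      ring
  have hstep : ∀ n : ℕ, 1 ≤ n → R n < R (n + 1) := fun n hn => by
    have := Gamma_ratio_lt_Gamma_ratio_add_one (x := n) (by exact_mod_cast hn) ha0 ha1
    simpa only [hR, Nat.cast_add, Nat.cast_one] using this
  have hmono : ∀ n : ℕ, 2 ≤ n → R 2 ≤ R n := fun n hn => by
    induction n, hn using Nat.le_induction with
    | base => exact le_rfl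
    | succ k hk ih => exact ih.trans (hstep k (by omega)).le
  have hR12 : R 1 < R 2 := hstep 1 le_rfl
  have hlow : ∀ n : ℕ, 1 ≤ n → (n : ℝ) ^ (α - 1) / 2 ≤ R n := fun n hn => by
    have := le_Gamma_ratio (n := n) (by exact_mod_cast hn) ha0 ha1
    rwa [mul_div_cancel₀ α two_ne_zero] at this
  have hupp : ∀ n : ℕ, 1 ≤ n → R n ≤ 2 ^ (α - 1) * (n : ℝ) ^ (α - 1) := fun n hn => by
    have := Gamma_ratio_le (n := n) (by exact_mod_cast hn) ha0 ha1
    rwa [mul_div_cancel₀ α two_ne_zero] at this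
  have hpos1 : 0 < R 1 := lt_of_lt_of_le (by simp) (hlow 1 le_rfl)
  have hpos2 : 0 < R 2 := hpos1.trans hR12
  refine ⟨fun n hn => ?_, ⟨K * (R 2 - R 1), mul_pos hK (sub_pos.2 hR12), fun n hn => ?_⟩,
    ⟨K * ((1 - R 1 / R 2) / 2), ?_, K * 2 ^ (α - 1), by positivity, fun n hn => ⟨?_, ?_⟩⟩⟩
  · rw [hσK, hσK]
    have := hstep n (by omega)
    gcongr
  · rw [hσK]
    have := hmono n hn
    gcongr
  · have : 0 < 1 - R 1 / R 2 := sub_pos.2 ((div_lt_one hpos2).2 hR12)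
    positivity
  · rw [hσK, mul_assoc]
    have hc : 0 < 1 - R 1 / R 2 := sub_pos.2 ((div_lt_one hpos2).2 hR12)
    refine mul_le_mul_of_nonneg_left ?_ hK.le
    calc (1 - R 1 / R 2) / 2 * (n : ℝ) ^ (α - 1)
        = (1 - R 1 / R 2) * ((n : ℝ) ^ (α - 1) / 2) := by ring
      _ ≤ (1 - R 1 / R 2) * R n := mul_le_mul_of_nonneg_left (hlow n (by omega)) hc.le
      _ = R n - R 1 / R 2 * R n := by ring
      _ ≤ R n - R 1 / R 2 * R 2 := by
        have := hmono n hn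
        gcongr
      _ = R n - R 1 := by rw [div_mul_cancel₀ _ hpos2.ne']
  · rw [hσK, mul_assoc]
    refine mul_le_mul_of_nonneg_left ?_ hK.le
    linarith [hupp n (by omega)]
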